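/- arXiv:2412.02146 — 8 statements merged into one kernel-verified Lean document; each statement's English description precedes it below -/
import Mathlib

section
/- Let Ω be a finite type, f : Finset Ω → ℝ be normalized, monotone, and submodular, and suppose f has elemental curvature at most κ ∈ [0,1]. Then for any finite subsets A, B ⊆ Ω with m = |B \ A| ≥ 1, one has f(A ∪ B) ≤ f(A) + ξ(m) · Σ_{x ∈ B \ A} (f(A ∪ {x}) − f(A)), where ξ(m) := (1 − κ^m)/(m(1 − κ)) if 0 ≤ κ < 1 and ξ(m) := 1 if κ = 1. -/
/-- Curvature-refined union bound, with the factor `ξ(m)` cleared of denominators: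
`m (f(A ∪ D) - f(A)) ≤ (1 + κ + ⋯ + κ^(m-1)) Σ_{x ∈ D} (f(A ∪ {x}) - f(A))` for `m = |D|`. -/
theorem card_mul_union_sub_le_geom_sum_mul
    {Ω : Type*} [DecidableEq Ω] (f : Finset Ω → ℝ) (κ : ℝ) (hκ0 : 0 ≤ κ)
    (hcurv : ∀ (S : Finset Ω) (x x' : Ω), x ≠ x' → x ∉ S → x' ∉ S →
      f (insert x (insert x' S)) - f (insert x' S) ≤ κ * (f (insert x S) - f S))
    (m : ℕ) (A D : Finset Ω) (hD : D.card = m) (hAD : Disjoint D A) :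
    m * (f (A ∪ D) - f A) ≤
      (∑ i ∈ Finset.range m, κ ^ i) * ∑ x ∈ D, (f (insert x A) - f A) := by
  induction m generalizing A D with
  | zero => simp
  | succ n ih =>
    rcases Nat.eq_zero_or_pos n with rfl | hn
    · obtain ⟨a, rfl⟩ := Finset.card_eq_one.mp hD
      simp [Finset.union_comm A]
    · set S := ∑ x ∈ D, (f (insert x A) - f A) with hS
      set G := ∑ i ∈ Finset.range n, κ ^ i with hG
      have hG0 : 0 ≤ G := Finset.sum_nonneg fun i _ => pow_nonneg hκ0 i
      have step : ∀ y ∈ D, n * (f (A ∪ D) - f A) ≤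
          n * (f (insert y A) - f A) + G * (κ * (S - (f (insert y A) - f A))) := by
        intro y hy
        have hyA : y ∉ A := Finset.disjoint_left.mp hAD hy
        have hdisj : Disjoint (D.erase y) (insert y A) := by
          rw [Finset.disjoint_insert_right]
          exact ⟨Finset.notMem_erase y D, hAD.mono_left (Finset.erase_subset y D)⟩
        have hunion : insert y A ∪ D.erase y = A ∪ D := by
          rw [Finset.insert_union, ← Finset.union_insert, Finset.insert_erase hy]
        have hrec := ih (insert y A) (D.erase y)
          (by rw [Finset.card_erase_of_mem hy, hD, Nat.add_sub_cancel]) hdisj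
        rw [hunion] at hrec
        have hmarg : ∑ x ∈ D.erase y, (f (insert x (insert y A)) - f (insert y A)) ≤
            κ * (S - (f (insert y A) - f A)) := by
          rw [hS, ← Finset.sum_erase_eq_sub hy, Finset.mul_sum]
          refine Finset.sum_le_sum fun x hx => ?_
          obtain ⟨hxy, hxD⟩ := Finset.mem_erase.mp hx
          exact hcurv A x y hxy (Finset.disjoint_left.mp hAD hxD) hyA
        linarith [mul_le_mul_of_nonneg_left hmarg hG0]
      have hsum := Finset.sum_le_sum step
      rw [Finset.sum_const, hD, nsmul_eq_mul, Finset.sum_add_distrib, ← Finset.mul_sum,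
        ← hS, ← Finset.mul_sum, ← Finset.mul_sum, Finset.sum_sub_distrib, Finset.sum_const, hD,
        nsmul_eq_mul, ← hS] at hsum
      have hn' : (0 : ℝ) < n := by exact_mod_cast hn
      rw [geom_sum_succ, ← hG]
      refine le_of_mul_le_mul_left ?_ hn'
      push_cast at hsum ⊢
      linarith


/-- **First claim of the paper's Lemma 4.** For a normalized, monotone, submodular
set function `f` with elemental curvature at most `κ ∈ [0,1]`, and finite sets
`A, B` with `m = |B \ A| ≥ 1`,
`f(A ∪ B) ≤ f(A) + ξ(m) · Σ_{x ∈ B \ A} (f(A ∪ {x}) − f(A))`,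
where `ξ(m) = (1 − κ^m)/(m(1 − κ))` when `0 ≤ κ < 1` and `ξ(m) = 1` when `κ = 1`. -/
theorem submodular_union_bound_curvature
    {Ω : Type*} [Fintype Ω] [DecidableEq Ω]
    (f : Finset Ω → ℝ) (κ : ℝ)
    (hκ0 : 0 ≤ κ) (hκ1 : κ ≤ 1)
    (hnorm : f ∅ = 0)
    (hmono : ∀ S S' : Finset Ω, S ⊆ S' → f S ≤ f S')
    (hsub : ∀ (S S' : Finset Ω) (x : Ω), S ⊆ S' → x ∉ S' →
      f (insert x S') - f S' ≤ f (insert x S) - f S)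
    (hcurv : ∀ (S : Finset Ω) (x x' : Ω), x ≠ x' → x ∉ S → x' ∉ S →
      f (insert x (insert x' S)) - f (insert x' S) ≤ κ * (f (insert x S) - f S))
    (A B : Finset Ω) (m : ℕ) (hm : m = (B \ A).card) (hm1 : 1 ≤ m) :
    f (A ∪ B) ≤ f A +
      (if κ = 1 then (1 : ℝ) else (1 - κ ^ m) / (m * (1 - κ))) *
        ∑ x ∈ B \ A, (f (insert x A) - f A) := by
  subst hm
  have hm0 : (0 : ℝ) < ((B \ A).card : ℝ) := by exact_mod_cast hm1
  have key := card_mul_union_sub_le_geom_sum_mul f κ hκ0 hcurv _ A (B \ A) rfl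
    Finset.sdiff_disjoint
  rw [Finset.union_sdiff_self_eq_union] at key
  have hξ : (if κ = 1 then (1 : ℝ) else (1 - κ ^ (B \ A).card) / ((B \ A).card * (1 - κ))) =
      (∑ i ∈ Finset.range (B \ A).card, κ ^ i) / (B \ A).card := by
    split_ifs with h
    · simp [h, hm0.ne']
    · have h1 : 1 - κ ≠ 0 := sub_ne_zero.mpr (Ne.symm h)
      rw [← geom_sum_mul_neg κ (B \ A).card]
      field_simp
  rw [hξ, div_mul_eq_mul_div, ← sub_le_iff_le_add', le_div_iff₀ hm0]
  linarith
end

section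
/- Let Ω be a finite type, f : Finset Ω → ℝ be normalized, monotone, and submodular, and suppose f has elemental curvature at most κ ∈ [0,1]. Then for any finite subsets A ⊆ B ⊆ Ω with m = |B \ A| and any x ∉ B, one has κ^m · (f(A ∪ {x}) − f(A)) ≥ f(B ∪ {x}) − f(B). -/
/-- If adding one element to a set shrinks every other marginal of `f` by a factor `κ`, then adding
a disjoint set `T` shrinks it by `κ ^ #T`. -/
theorem marginal_union_le_pow_card_mul {Ω : Type*} [DecidableEq Ω] {f : Finset Ω → ℝ} {κ : ℝ}
    (hκ : 0 ≤ κ)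
    (hcurv : ∀ (S : Finset Ω) (x x' : Ω), x ≠ x' → x ∉ S → x' ∉ S →
      f (insert x (insert x' S)) - f (insert x' S) ≤ κ * (f (insert x S) - f S))
    {A T : Finset Ω} (hAT : Disjoint T A) {x : Ω} (hx : x ∉ T ∪ A) :
    f (insert x (T ∪ A)) - f (T ∪ A) ≤ κ ^ T.card * (f (insert x A) - f A) := by
  induction T using Finset.induction_on with
  | empty => simp
  | insert y T hy ih =>
    rw [Finset.disjoint_insert_left] at hAT
    rw [Finset.insert_union, Finset.mem_insert, not_or] at hx
    rw [Finset.insert_union, Finset.card_insert_of_notMem hy, pow_succ', mul_assoc]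
    have hyTA : y ∉ T ∪ A := by simp [hy, hAT.1]
    exact (hcurv _ x y hx.1 hx.2 hyTA).trans
      (mul_le_mul_of_nonneg_left (ih hAT.2 hx.2) hκ)

/-- **Second claim of the paper's Lemma 4.** For a normalized, monotone, submodular
set function `f` with elemental curvature at most `κ ∈ [0,1]`, and finite sets
`A ⊆ B` with `m = |B \ A|`, and any `x ∉ B`,
`κ^m · (f(A ∪ {x}) − f(A)) ≥ f(B ∪ {x}) − f(B)`. -/
theorem marginal_curvature_bound
    {Ω : Type*} [Fintype Ω] [DecidableEq Ω]
    (f : Finset Ω → ℝ) (κ : ℝ)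
    (hκ0 : 0 ≤ κ) (hκ1 : κ ≤ 1)
    (hnorm : f ∅ = 0)
    (hmono : ∀ S S' : Finset Ω, S ⊆ S' → f S ≤ f S')
    (hsub : ∀ (S S' : Finset Ω) (x : Ω), S ⊆ S' → x ∉ S' →
      f (insert x S') - f S' ≤ f (insert x S) - f S)
    (hcurv : ∀ (S : Finset Ω) (x x' : Ω), x ≠ x' → x ∉ S → x' ∉ S →
      f (insert x (insert x' S)) - f (insert x' S) ≤ κ * (f (insert x S) - f S))
    (A B : Finset Ω) (hAB : A ⊆ B) (m : ℕ) (hm : m = (B \ A).card)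
    (x : Ω) (hx : x ∉ B) :
    f (insert x B) - f B ≤ κ ^ m * (f (insert x A) - f A) := by
  have hB : B \ A ∪ A = B := Finset.sdiff_union_of_subset hAB
  have h := marginal_union_le_pow_card_mul hκ0 hcurv (A := A) (T := B \ A)
    Finset.sdiff_disjoint (x := x) (by rwa [hB])
  rwa [hB, ← hm] at h
end

section
/- Let I and J be finite types, and for each j ∈ J let f_j : Finset (I × J) → ℝ be a set function that depends only on the elements with second coordinate j, i.e., f_j(S) = f_j(S ∩ (I × {j})) for all S. Set f(S) = Σ_{j ∈ J} f_j(S). Then for any finite S ⊆ I × J and any finite A ⊆ I × J disjoint from S whose elements have pairwise distinct second coordinates, f(S ∪ A) − f(S) = Σ_{a ∈ A} (f(S ∪ {a}) − f(S)). -/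
/-- If `g` depends only on the pairs with second coordinate `j`, then adding to `S` a set `B` with
no pair of the same second coordinate as `a` does not change the marginal value of `a`. -/
theorem marginal_union_eq_of_target_notMem
    {I J : Type*} [DecidableEq I] [DecidableEq J] {j : J} {g : Finset (I × J) → ℝ}
    (hg : ∀ S : Finset (I × J), g S = g (S.filter (fun p => p.2 = j)))
    (S : Finset (I × J)) {B : Finset (I × J)} {a : I × J} (ha : ∀ b ∈ B, a.2 ≠ b.2) :
    g (insert a (S ∪ B)) - g (S ∪ B) = g (insert a S) - g S := by
  rw [hg (insert a (S ∪ B)), hg (S ∪ B), hg (insert a S), hg S]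
  by_cases h : a.2 = j
  · have hB : B.filter (fun p => p.2 = j) = ∅ :=
      Finset.filter_eq_empty_iff.mpr fun b hb hbj => ha b hb (h.trans hbj.symm)
    simp [Finset.filter_insert, Finset.filter_union, hB]
  · simp [Finset.filter_insert, h]

/-- **Property 3 of the paper's Lemma 1.** If `f = Σ_j f_j` where each `f_j` depends
only on the pairs with second coordinate `j`, then for any `S` and any set `A`
disjoint from `S` whose elements have pairwise distinct second coordinates, the total
marginal utility of adding `A` equals the sum of individual marginal utilities. -/
theorem marginal_additivity_distinct_targets
    {I J : Type*} [Fintype I] [Fintype J] [DecidableEq I] [DecidableEq J]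
    (fj : J → Finset (I × J) → ℝ)
    (hdep : ∀ (j : J) (S : Finset (I × J)),
      fj j S = fj j (S.filter (fun p => p.2 = j)))
    (f : Finset (I × J) → ℝ)
    (hf : ∀ S : Finset (I × J), f S = ∑ j : J, fj j S)
    (S A : Finset (I × J))
    (hdisj : Disjoint S A)
    (hdistinct : ∀ a ∈ A, ∀ a' ∈ A, a ≠ a' → a.2 ≠ a'.2) :
    f (S ∪ A) - f S = ∑ a ∈ A, (f (insert a S) - f S) := by
  simp only [hf, ← Finset.sum_sub_distrib]
  clear hdisj
  induction A using Finset.induction_on with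
  | empty => simp
  | insert a B ha ih =>
    have hB : ∀ b ∈ B, a.2 ≠ b.2 := fun b hb =>
      hdistinct a (Finset.mem_insert_self a B) b (Finset.mem_insert_of_mem hb)
        (ne_of_mem_of_not_mem hb ha).symm
    rw [Finset.sum_insert ha, ← ih fun b hb c hc => hdistinct b (Finset.mem_insert_of_mem hb) c
      (Finset.mem_insert_of_mem hc), ← Finset.sum_add_distrib]
    refine Finset.sum_congr rfl fun j _ => ?_
    rw [← marginal_union_eq_of_target_notMem (hdep j) S hB, Finset.union_insert]
    ring
end

section
/- Consider an abstract greedy run with horizon T ≥ 1 for a normalized, monotone, submodular set function f : Finset (I × J) → ℝ, with final allocation Π̂ = Π(T), and let Π* = {(i, j*(i)) : i ∈ I} be any allocation satisfying the greedy-dominance property. Then f(Π*) ≤ 2 · f(Π̂), i.e., f(Π̂) ≥ (1/2) · f(Π*). -/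
open Finset

/-- The marginal gain of a monotone submodular set function is antitone in the base set, including
when the added element already belongs to the larger set. -/
lemma marginal_antitone_of_submodular {α : Type*} [DecidableEq α] {f : Finset α → ℝ}
    (hmono : ∀ S S' : Finset α, S ⊆ S' → f S ≤ f S')
    (hsub : ∀ (S S' : Finset α) (x : α), S ⊆ S' → x ∉ S' →
      f (insert x S') - f S' ≤ f (insert x S) - f S)
    {S S' : Finset α} (hS : S ⊆ S') (x : α) :
    f (insert x S') - f S' ≤ f (insert x S) - f S := by
  by_cases hx : x ∈ S'
  · rw [Finset.insert_eq_of_mem hx, sub_self]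
    exact sub_nonneg.2 (hmono _ _ (Finset.subset_insert x S))
  · exact hsub S S' x hS hx

/-- If each marginal gain of `g i` over supersets of `A` is at most `c i`, then adding all `g i`
to `A` increases `f` by at most the sum of the `c i`. -/
lemma union_image_le_add_sum {ι α : Type*} [DecidableEq α] {f : Finset α → ℝ}
    {A : Finset α} {g : ι → α} {c : ι → ℝ}
    (h : ∀ i B, A ⊆ B → f (insert (g i) B) - f B ≤ c i) (s : Finset ι) :
    f (A ∪ s.image g) ≤ f A + ∑ i ∈ s, c i := by
  classical
  induction s using Finset.induction_on with
  | empty => simp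
  | insert i s hi ih =>
    rw [Finset.image_insert, Finset.union_insert, Finset.sum_insert hi]
    linarith [h i (A ∪ s.image g) Finset.subset_union_left]

/-- **Theorem 2 of the paper (performance bound of DGBA).** For an abstract greedy run
with horizon `T ≥ 1` of a normalized, monotone, submodular set function `f`, with final
allocation `Π̂ = Pa T`, and any allocation `Π* = {(i, j*(i)) : i ∈ I}` satisfying the
greedy-dominance property, one has `f(Π*) ≤ 2 · f(Π̂)`. -/
theorem dgba_half_performance_bound
    {I J : Type*} [Fintype I] [Fintype J] [Nonempty I] [Nonempty J]
    [DecidableEq I] [DecidableEq J]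
    (f : Finset (I × J) → ℝ)
    (hnorm : f ∅ = 0)
    (hmono : ∀ S S' : Finset (I × J), S ⊆ S' → f S ≤ f S')
    (hsub : ∀ (S S' : Finset (I × J)) (x : I × J), S ⊆ S' → x ∉ S' →
      f (insert x S') - f S' ≤ f (insert x S) - f S)
    (T : ℕ) (hT : 1 ≤ T)
    (Pa : ℕ → Finset (I × J)) (hPa0 : Pa 0 = ∅)
    (jhat : I → J) (τ : I → ℕ) (hτ : ∀ i, τ i < T)
    (hstep : ∀ t < T, Pa (t + 1) =
      Pa t ∪ (Finset.univ.filter (fun i : I => τ i = t)).image (fun i => (i, jhat i)))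
    (hnotmem : ∀ i : I, (i, jhat i) ∉ Pa (τ i))
    (hadd : ∀ t < T, f (Pa (t + 1)) - f (Pa t) =
      ∑ i ∈ Finset.univ.filter (fun i : I => τ i = t),
        (f (insert (i, jhat i) (Pa t)) - f (Pa t)))
    (jstar : I → J)
    (hdom : ∀ i : I,
      f (insert (i, jstar i) (Pa (τ i))) - f (Pa (τ i)) ≤
      f (insert (i, jhat i) (Pa (τ i))) - f (Pa (τ i))) :
    f (Finset.univ.image (fun i : I => (i, jstar i))) ≤ 2 * f (Pa T) := by
  have hchain : ∀ t ≤ T, ∀ s ≤ t, Pa s ⊆ Pa t := by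
    intro t ht s hst
    induction t, hst using Nat.le_induction with
    | base => exact Finset.Subset.refl _
    | succ t _ ih =>
      rw [hstep t ht]
      exact (ih (Nat.le_of_succ_le ht)).trans Finset.subset_union_left
  have hsum : ∑ i, (f (insert (i, jhat i) (Pa (τ i))) - f (Pa (τ i))) = f (Pa T) := by
    rw [← Finset.sum_fiberwise_of_maps_to (t := Finset.range T) (g := τ)
      (fun i _ => Finset.mem_range.2 (hτ i))]
    calc
      _ = ∑ t ∈ Finset.range T, (f (Pa (t + 1)) - f (Pa t)) := by
        refine Finset.sum_congr rfl fun t ht => ?_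
        rw [hadd t (Finset.mem_range.1 ht)]
        refine Finset.sum_congr rfl fun i hi => ?_
        rw [(Finset.mem_filter.1 hi).2]
      _ = f (Pa T) := by
        rw [Finset.sum_range_sub (fun t => f (Pa t)), hPa0, hnorm, sub_zero]
  have hunion := union_image_le_add_sum (f := f) (A := Pa T) (g := fun i => (i, jstar i))
    (fun i B hB => (marginal_antitone_of_submodular hmono hsub
      ((hchain T le_rfl (τ i) (hτ i).le).trans hB) (i, jstar i)).trans (hdom i)) Finset.univ
  rw [hsum] at hunion
  linarith [hmono (Finset.univ.image fun i => (i, jstar i)) _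
    (Finset.subset_union_right (s₁ := Pa T))]
end

section
/- Consider an abstract greedy run with horizon T ≥ 1 for a normalized, monotone, submodular set function f : Finset (I × J) → ℝ that moreover has elemental curvature at most κ ∈ [0,1], with final allocation Π̂ = Π(T), and let Π* = {(i, j*(i)) : i ∈ I} be any allocation satisfying the greedy-dominance property. Then f(Π*) ≤ (1 + κ) · f(Π̂), i.e., f(Π̂) ≥ f(Π*)/(1 + κ). -/
open Finset

/-- A monotone submodular set function gains from adjoining a finite family at most the sum of
the individual marginal gains. -/
theorem submodular_union_image_le {α ι : Type*} [DecidableEq α] (f : Finset α → ℝ)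
    (hmono : ∀ S S' : Finset α, S ⊆ S' → f S ≤ f S')
    (hsub : ∀ (S S' : Finset α) (x : α), S ⊆ S' → x ∉ S' →
      f (insert x S') - f S' ≤ f (insert x S) - f S)
    (A : Finset α) (g : ι → α) (s : Finset ι) :
    f (A ∪ s.image g) ≤ f A + ∑ i ∈ s, (f (insert (g i) A) - f A) := by
  classical
  induction s using Finset.induction_on with
  | empty => simp
  | insert i s hi ih =>
    rw [Finset.sum_insert hi, Finset.image_insert, Finset.union_insert]
    by_cases hmem : g i ∈ A ∪ s.image g
    · rw [Finset.insert_eq_self.mpr hmem]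
      linarith [hmono A (insert (g i) A) (Finset.subset_insert _ _)]
    · linarith [hsub A (A ∪ s.image g) (g i) Finset.subset_union_left hmem]

/-- If the increments of `a` over `t < T` are sums over the fibres of `τ`, then the total increment
is the sum over the whole index type. -/
theorem sub_eq_sum_of_fiberwise_increments {I : Type*} [Fintype I]
    (T : ℕ) (τ : I → ℕ) (hτ : ∀ i, τ i < T) (a : ℕ → ℝ) (d : I → ℝ)
    (h : ∀ t < T, a (t + 1) - a t = ∑ i ∈ Finset.univ.filter (fun i : I => τ i = t), d i) :
    a T - a 0 = ∑ i, d i := by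
  rw [← Finset.sum_range_sub,
    ← Finset.sum_fiberwise_of_maps_to (fun i _ => Finset.mem_range.mpr (hτ i)) d]
  exact Finset.sum_congr rfl fun t ht => h t (Finset.mem_range.mp ht)

/-- **Theorem 3 of the paper (curvature-tightened performance bound of DGBA).**
For an abstract greedy run with horizon `T ≥ 1` of a normalized, monotone, submodular
set function `f` with elemental curvature at most `κ ∈ [0,1]`, with final allocation
`Π̂ = Pa T`, and any allocation `Π* = {(i, j*(i)) : i ∈ I}` satisfying the
greedy-dominance property, one has `f(Π*) ≤ (1 + κ) · f(Π̂)`. -/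
theorem dgba_curvature_performance_bound
    {I J : Type*} [Fintype I] [Fintype J] [Nonempty I] [Nonempty J]
    [DecidableEq I] [DecidableEq J]
    (f : Finset (I × J) → ℝ) (κ : ℝ)
    (hκ0 : 0 ≤ κ) (hκ1 : κ ≤ 1)
    (hnorm : f ∅ = 0)
    (hmono : ∀ S S' : Finset (I × J), S ⊆ S' → f S ≤ f S')
    (hsub : ∀ (S S' : Finset (I × J)) (x : I × J), S ⊆ S' → x ∉ S' →
      f (insert x S') - f S' ≤ f (insert x S) - f S)
    (hcurv : ∀ (S : Finset (I × J)) (x x' : I × J), x ≠ x' → x ∉ S → x' ∉ S →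
      f (insert x (insert x' S)) - f (insert x' S) ≤ κ * (f (insert x S) - f S))
    (T : ℕ) (hT : 1 ≤ T)
    (Pa : ℕ → Finset (I × J)) (hPa0 : Pa 0 = ∅)
    (jhat : I → J) (τ : I → ℕ) (hτ : ∀ i, τ i < T)
    (hstep : ∀ t < T, Pa (t + 1) =
      Pa t ∪ (Finset.univ.filter (fun i : I => τ i = t)).image (fun i => (i, jhat i)))
    (hnotmem : ∀ i : I, (i, jhat i) ∉ Pa (τ i))
    (hadd : ∀ t < T, f (Pa (t + 1)) - f (Pa t) =
      ∑ i ∈ Finset.univ.filter (fun i : I => τ i = t),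
        (f (insert (i, jhat i) (Pa t)) - f (Pa t)))
    (jstar : I → J)
    (hdom : ∀ i : I,
      f (insert (i, jstar i) (Pa (τ i))) - f (Pa (τ i)) ≤
      f (insert (i, jhat i) (Pa (τ i))) - f (Pa (τ i))) :
    f (Finset.univ.image (fun i : I => (i, jstar i))) ≤ (1 + κ) * f (Pa T) := by
  have hchain : ∀ s t : ℕ, s ≤ t → t ≤ T → Pa s ⊆ Pa t := by
    intro s t hst
    induction t, hst using Nat.le_induction with
    | base => exact fun _ => subset_rfl
    | succ t _ ih =>
      intro ht
      rw [hstep t ht]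
      exact (ih (Nat.le_of_succ_le ht)).trans Finset.subset_union_left
  have hgreedy_subset : ∀ i, insert (i, jhat i) (Pa (τ i)) ⊆ Pa T := by
    intro i
    refine Finset.Subset.trans ?_ (hchain (τ i + 1) T (hτ i) le_rfl)
    rw [hstep _ (hτ i)]
    refine Finset.insert_subset (Finset.mem_union_right _ ?_) Finset.subset_union_left
    exact Finset.mem_image.mpr ⟨i, by simp, rfl⟩
  have hmarginal : ∀ i, f (insert (i, jstar i) (Pa T)) - f (Pa T) ≤
      κ * (f (insert (i, jhat i) (Pa (τ i))) - f (Pa (τ i))) := by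
    intro i
    by_cases hmem : (i, jstar i) ∈ Pa T
    · rw [Finset.insert_eq_self.mpr hmem, sub_self]
      exact mul_nonneg hκ0 (sub_nonneg.mpr (hmono _ _ (Finset.subset_insert _ _)))
    · have hnot : (i, jstar i) ∉ insert (i, jhat i) (Pa (τ i)) :=
        fun h => hmem (hgreedy_subset i h)
      rw [Finset.mem_insert, not_or] at hnot
      calc f (insert (i, jstar i) (Pa T)) - f (Pa T)
          ≤ f (insert (i, jstar i) (insert (i, jhat i) (Pa (τ i)))) -
              f (insert (i, jhat i) (Pa (τ i))) := hsub _ _ _ (hgreedy_subset i) hmem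
        _ ≤ κ * (f (insert (i, jstar i) (Pa (τ i))) - f (Pa (τ i))) :=
            hcurv _ _ _ hnot.1 hnot.2 (hnotmem i)
        _ ≤ κ * (f (insert (i, jhat i) (Pa (τ i))) - f (Pa (τ i))) :=
            mul_le_mul_of_nonneg_left (hdom i) hκ0
  have htotal : f (Pa T) = ∑ i, (f (insert (i, jhat i) (Pa (τ i))) - f (Pa (τ i))) := by
    have h := sub_eq_sum_of_fiberwise_increments T τ hτ (fun t => f (Pa t))
      (fun i => f (insert (i, jhat i) (Pa (τ i))) - f (Pa (τ i))) (by
        intro t ht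
        rw [hadd t ht]
        refine Finset.sum_congr rfl fun i hi => ?_
        rw [(Finset.mem_filter.mp hi).2])
    simpa only [hPa0, hnorm, sub_zero] using h
  calc f (Finset.univ.image (fun i : I => (i, jstar i)))
      ≤ f (Pa T ∪ Finset.univ.image (fun i : I => (i, jstar i))) :=
        hmono _ _ Finset.subset_union_right
    _ ≤ f (Pa T) + ∑ i, (f (insert (i, jstar i) (Pa T)) - f (Pa T)) :=
        submodular_union_image_le f hmono hsub _ _ _
    _ ≤ f (Pa T) + ∑ i, κ * (f (insert (i, jhat i) (Pa (τ i))) - f (Pa (τ i))) := by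
        gcongr with i
        exact hmarginal i
    _ = (1 + κ) * f (Pa T) := by
        rw [← Finset.mul_sum, ← htotal]
        ring
end

section
/- Consider an abstract greedy run with horizon T ≥ 1 for a normalized, monotone, submodular set function f : Finset (I × J) → ℝ that moreover has elemental curvature at most κ ∈ [0,1], with final allocation Π̂ = Π(T), and let Π* = {(i, j*(i)) : i ∈ I} be any allocation satisfying the greedy-dominance property. Suppose in addition that m := |Π* \ Π̂| ≥ 1 and that there is an integer q ≥ 1 with q · m = (q − 1) · |I| (i.e., m = (1 − 1/q) · N where N = |I|). Then f(Π*) ≤ (1 + κ · ξ(m)) · f(Π̂), where ξ(m) := (1 − κ^m)/(m(1 − κ)) if 0 ≤ κ < 1 and ξ(m) := 1 if κ = 1; equivalently, f(Π̂) ≥ f(Π*)/(1 + κ · ξ((1 − 1/q)N)). -/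
open Finset

/-- Adding a set `D` disjoint from `S` one element at a time, averaged over the orders of insertion:
if `f` has elemental curvature at most `κ`, the gain of `D` over `S` is at most the sum of the single
gains, scaled by the mean of `1, κ, …, κ ^ (#D - 1)`. -/
theorem card_mul_sub_le_geom_sum_mul_sum {α : Type*} [DecidableEq α]
    (f : Finset α → ℝ) (κ : ℝ) (hκ0 : 0 ≤ κ)
    (hcurv : ∀ (S : Finset α) (x x' : α), x ≠ x' → x ∉ S → x' ∉ S →
      f (insert x (insert x' S)) - f (insert x' S) ≤ κ * (f (insert x S) - f S))
    (n : ℕ) (S D : Finset α) (hD : D.card = n) (hdisj : ∀ d ∈ D, d ∉ S) :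
    (n : ℝ) * (f (S ∪ D) - f S) ≤
      (∑ k ∈ Finset.range n, κ ^ k) * ∑ d ∈ D, (f (insert d S) - f S) := by
  induction n generalizing S D with
  | zero => simp
  | succ n ih =>
    obtain rfl | hn := Nat.eq_zero_or_pos n
    · obtain ⟨d, rfl⟩ := Finset.card_eq_one.mp hD
      simp [Finset.union_singleton]
    have hG : 0 ≤ ∑ k ∈ Finset.range n, κ ^ k :=
      Finset.sum_nonneg fun k _ => pow_nonneg hκ0 k
    have hn' : (0 : ℝ) < n := by exact_mod_cast hn
    set G := ∑ k ∈ Finset.range n, κ ^ k with hGdef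
    set A := ∑ d ∈ D, (f (insert d S) - f S) with hA
    have key : ∀ d ∈ D, (n : ℝ) * ((f (S ∪ D) - f S) - (f (insert d S) - f S)) ≤
        G * (κ * (A - (f (insert d S) - f S))) := by
      intro d hd
      have hcard : (D.erase d).card = n := by
        rw [Finset.card_erase_of_mem hd, hD]; rfl
      have hunion : insert d S ∪ D.erase d = S ∪ D := by
        rw [Finset.insert_union, ← Finset.union_insert, Finset.insert_erase hd]
      have h := ih (insert d S) (D.erase d) hcard (by
        intro e he
        rw [Finset.mem_insert, not_or]
        exact ⟨Finset.ne_of_mem_erase he, hdisj e (Finset.mem_of_mem_erase he)⟩)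
      rw [hunion] at h
      have hsum : ∑ e ∈ D.erase d, (f (insert e (insert d S)) - f (insert d S)) ≤
          κ * (A - (f (insert d S) - f S)) := by
        rw [hA, ← Finset.sum_erase_eq_sub hd, Finset.mul_sum]
        exact Finset.sum_le_sum fun e he => hcurv S e d (Finset.ne_of_mem_erase he)
          (hdisj e (Finset.mem_of_mem_erase he)) (hdisj d hd)
      have hmul := mul_le_mul_of_nonneg_left hsum hG
      linarith
    have hall := Finset.sum_le_sum key
    simp only [← Finset.mul_sum, Finset.sum_sub_distrib (s := D) (f := fun _ => f (S ∪ D) - f S),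
      Finset.sum_sub_distrib (s := D) (f := fun _ => A), Finset.sum_const, hD, nsmul_eq_mul,
      ← hA] at hall
    rw [geom_sum_succ, ← hGdef]
    push_cast at hall ⊢
    refine le_of_mul_le_mul_left ?_ hn'
    linarith

/-- **Theorem 4 of the paper (performance bound under the q-independent system).**
For an abstract greedy run with horizon `T ≥ 1` of a normalized, monotone, submodular
set function `f` with elemental curvature at most `κ ∈ [0,1]`, with final allocation
`Π̂ = Pa T`, an allocation `Π* = {(i, j*(i)) : i ∈ I}` satisfying the greedy-dominance
property, with `m = |Π* \ Π̂| ≥ 1` and an integer `q ≥ 1` such that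
`q · m = (q − 1) · |I|` (i.e. `m = (1 − 1/q)·N`), one has
`f(Π*) ≤ (1 + κ · ξ(m)) · f(Π̂)` where `ξ(m) = (1 − κ^m)/(m(1 − κ))` for `κ < 1`
and `ξ(m) = 1` for `κ = 1`. -/
theorem dgba_q_independent_performance_bound
    {I J : Type*} [Fintype I] [Fintype J] [Nonempty I] [Nonempty J]
    [DecidableEq I] [DecidableEq J]
    (f : Finset (I × J) → ℝ) (κ : ℝ)
    (hκ0 : 0 ≤ κ) (hκ1 : κ ≤ 1)
    (hnorm : f ∅ = 0)
    (hmono : ∀ S S' : Finset (I × J), S ⊆ S' → f S ≤ f S')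
    (hsub : ∀ (S S' : Finset (I × J)) (x : I × J), S ⊆ S' → x ∉ S' →
      f (insert x S') - f S' ≤ f (insert x S) - f S)
    (hcurv : ∀ (S : Finset (I × J)) (x x' : I × J), x ≠ x' → x ∉ S → x' ∉ S →
      f (insert x (insert x' S)) - f (insert x' S) ≤ κ * (f (insert x S) - f S))
    (T : ℕ) (hT : 1 ≤ T)
    (Pa : ℕ → Finset (I × J)) (hPa0 : Pa 0 = ∅)
    (jhat : I → J) (τ : I → ℕ) (hτ : ∀ i, τ i < T)
    (hstep : ∀ t < T, Pa (t + 1) =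
      Pa t ∪ (Finset.univ.filter (fun i : I => τ i = t)).image (fun i => (i, jhat i)))
    (hnotmem : ∀ i : I, (i, jhat i) ∉ Pa (τ i))
    (hadd : ∀ t < T, f (Pa (t + 1)) - f (Pa t) =
      ∑ i ∈ Finset.univ.filter (fun i : I => τ i = t),
        (f (insert (i, jhat i) (Pa t)) - f (Pa t)))
    (jstar : I → J)
    (hdom : ∀ i : I,
      f (insert (i, jstar i) (Pa (τ i))) - f (Pa (τ i)) ≤
      f (insert (i, jhat i) (Pa (τ i))) - f (Pa (τ i)))
    (m : ℕ)
    (hm : m = ((Finset.univ.image (fun i : I => (i, jstar i))) \ Pa T).card)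
    (hm1 : 1 ≤ m)
    (q : ℕ) (hq : 1 ≤ q)
    (hqm : q * m = (q - 1) * Fintype.card I) :
    f (Finset.univ.image (fun i : I => (i, jstar i))) ≤
      (1 + κ * (if κ = 1 then (1 : ℝ) else (1 - κ ^ m) / (m * (1 - κ)))) * f (Pa T) := by
  set P : Finset (I × J) := Finset.univ.image fun i : I => (i, jstar i) with hP
  let gain : I → ℝ := fun i => f (insert (i, jhat i) (Pa (τ i))) - f (Pa (τ i))
  have hgain : ∀ i, 0 ≤ gain i := fun i =>
    sub_nonneg.mpr (hmono _ _ (Finset.subset_insert _ _))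
  have hchain : ∀ t ≤ T, Pa t ⊆ Pa T := fun t ht =>
    Nat.decreasingInduction (motive := fun t _ => Pa t ⊆ Pa T)
      (fun k hk h => (hstep k hk ▸ Finset.subset_union_left : Pa k ⊆ Pa (k + 1)).trans h)
      (Finset.Subset.refl _) ht
  have hhat : ∀ i, (i, jhat i) ∈ Pa T := fun i => hchain (τ i + 1) (hτ i) (by
    rw [hstep _ (hτ i)]
    exact Finset.mem_union_right _ (Finset.mem_image_of_mem _ (by simp)))
  have htotal : ∑ i, gain i = f (Pa T) := by
    have htel := Finset.sum_range_sub (fun t => f (Pa t)) T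
    rw [hPa0, hnorm, sub_zero] at htel
    rw [← htel, ← Finset.sum_fiberwise_of_maps_to (s := Finset.univ) (t := Finset.range T) (g := τ)
      (fun i _ => Finset.mem_range.mpr (hτ i))]
    refine Finset.sum_congr rfl fun t ht => ?_
    rw [hadd t (Finset.mem_range.mp ht)]
    refine Finset.sum_congr rfl fun i hi => ?_
    simp only [gain, (Finset.mem_filter.mp hi).2]
  have hsingle : ∀ e ∈ P \ Pa T, f (insert e (Pa T)) - f (Pa T) ≤ κ * gain e.1 := by
    intro e he
    obtain ⟨heP, heT⟩ := Finset.mem_sdiff.mp he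
    obtain ⟨i, -, rfl⟩ := Finset.mem_image.mp heP
    have hτT : Pa (τ i) ⊆ Pa T := hchain _ (hτ i).le
    calc f (insert (i, jstar i) (Pa T)) - f (Pa T)
        ≤ f (insert (i, jstar i) (insert (i, jhat i) (Pa (τ i)))) -
            f (insert (i, jhat i) (Pa (τ i))) :=
          hsub _ _ _ (Finset.insert_subset (hhat i) hτT) heT
      _ ≤ κ * (f (insert (i, jstar i) (Pa (τ i))) - f (Pa (τ i))) :=
          hcurv _ _ _ (fun h => heT (h ▸ hhat i)) (fun h => heT (hτT h)) (hnotmem i)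
      _ ≤ κ * gain i := mul_le_mul_of_nonneg_left (hdom i) hκ0
  have hsum : ∑ e ∈ P \ Pa T, (f (insert e (Pa T)) - f (Pa T)) ≤ κ * f (Pa T) :=
    calc ∑ e ∈ P \ Pa T, (f (insert e (Pa T)) - f (Pa T))
        ≤ ∑ e ∈ P \ Pa T, κ * gain e.1 := Finset.sum_le_sum hsingle
      _ ≤ ∑ e ∈ P, κ * gain e.1 :=
          Finset.sum_le_sum_of_subset_of_nonneg Finset.sdiff_subset
            fun e _ _ => mul_nonneg hκ0 (hgain e.1)
      _ = κ * f (Pa T) := by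
          rw [hP, Finset.sum_image (fun i _ i' _ h => congrArg Prod.fst h), ← Finset.mul_sum,
            htotal]
  have hm0 : (0 : ℝ) < m := by exact_mod_cast hm1
  have hxi : (if κ = 1 then (1 : ℝ) else (1 - κ ^ m) / (m * (1 - κ))) =
      (∑ k ∈ Finset.range m, κ ^ k) / m := by
    split_ifs with h
    · simp [h, hm0.ne']
    · have h1 : 1 - κ ≠ 0 := sub_ne_zero.mpr (Ne.symm h)
      rw [← geom_sum_mul_neg κ m]
      field_simp
  have havg := card_mul_sub_le_geom_sum_mul_sum f κ hκ0 hcurv m (Pa T) (P \ Pa T) hm.symm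
    fun e he => (Finset.mem_sdiff.mp he).2
  have hbound := havg.trans (mul_le_mul_of_nonneg_left hsum
    (Finset.sum_nonneg fun k _ => pow_nonneg hκ0 k))
  have hle : f P ≤ f (Pa T ∪ P \ Pa T) := hmono _ _ (by
    rw [Finset.union_sdiff_self_eq_union]
    exact Finset.subset_union_right)
  have hdiv := (le_div_iff₀' hm0).mpr hbound
  rw [hxi]
  calc f P ≤ f (Pa T) + (∑ k ∈ Finset.range m, κ ^ k) * (κ * f (Pa T)) / m := by linarith
    _ = _ := by ring
end

section
/- Let ι be a finite type and p : ι → ℝ satisfy 0 < p i < 1 for all i. Define g : Finset ι → ℝ by g(S) = 1 − ∏_{i ∈ S} (1 − p i). Then g(∅) = 0, g is monotone (S ⊆ S' implies g(S) ≤ g(S')), and g is submodular: for all S ⊆ S' ⊆ ι and x ∉ S', g(S ∪ {x}) − g(S) ≥ g(S' ∪ {x}) − g(S'). -/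
open Finset

/-- **Per-target coverage-probability function (core of the paper's Theorem 1).**
The function `g(S) = 1 − ∏_{i ∈ S} (1 − p i)` is normalized, monotone, and submodular. -/
theorem coverage_probability_submodular
    {ι : Type*} [Fintype ι] [DecidableEq ι]
    (p : ι → ℝ) (hp0 : ∀ i, 0 < p i) (hp1 : ∀ i, p i < 1)
    (g : Finset ι → ℝ)
    (hg : ∀ S : Finset ι, g S = 1 - ∏ i ∈ S, (1 - p i)) :
    g ∅ = 0 ∧
    (∀ S S' : Finset ι, S ⊆ S' → g S ≤ g S') ∧
    (∀ (S S' : Finset ι) (x : ι), S ⊆ S' → x ∉ S' →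
      g (insert x S') - g S' ≤ g (insert x S) - g S) := by
  have anti : Antitone fun S : Finset ι => ∏ i ∈ S, (1 - p i) :=
    Finset.prod_anti_set_of_le_one (fun i => by linarith [hp1 i]) (fun i => by linarith [hp0 i])
  refine ⟨by simp [hg], fun S S' h => ?_, fun S S' x h hx => ?_⟩
  · rw [hg, hg]
    exact sub_le_sub_left (anti h) 1
  · rw [hg, hg, hg, hg, Finset.prod_insert hx, Finset.prod_insert fun hxS => hx (h hxS)]
    linarith [mul_le_mul_of_nonneg_left (anti h) (hp0 x).le]
end

section
/- Let I and J be nonempty finite types, let c : I × J → ℝ be a cost function, and let C_min, C_max be reals with 0 < C_min and C_min ≤ c(i, j) ≤ C_max for all (i, j). Let E : I → ℝ be budgets with E i ≥ 0 for all i. Call a finite set Π ⊆ I × J feasible if for every agent i ∈ I, Σ_{(i', j) ∈ Π, i' = i} c(i', j) ≤ E i and |{(i', j) ∈ Π : i' = i}| ≤ 1. Then: (a) ∅ is feasible and feasibility is hereditary (every subset of a feasible set is feasible); and (b) for every finite Π ⊆ I × J and any two feasible sets Π₁, Π₂ ⊆ Π each maximal with respect to inclusion among feasible subsets of Π, one has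 |Π₁| ≤ q · |Π₂|, where q = ⌈1 + C_max/C_min⌉. In other words, the feasible sets form a q-independent system on the ground set I × J with q = ⌈1 + C_max/C_min⌉. -/
open Finset

/-- A finite allocation `A ⊆ I × J` is feasible if every agent `i` respects its
budget `E i` and is assigned at most one task. -/
def FeasibleAlloc {I J : Type*} [DecidableEq I]
    (c : I × J → ℝ) (E : I → ℝ) (A : Finset (I × J)) : Prop :=
  ∀ i : I,
    (∑ p ∈ A.filter (fun p => p.1 = i), c p) ≤ E i ∧
    (A.filter (fun p => p.1 = i)).card ≤ 1

namespace FeasibleAlloc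

variable {I J : Type*} [DecidableEq I] {c : I × J → ℝ} {E : I → ℝ} {A B : Finset (I × J)}

theorem empty (hE : ∀ i, 0 ≤ E i) : FeasibleAlloc c E ∅ := fun i => by simpa using hE i

theorem mono (hc : ∀ p, 0 ≤ c p) (hAB : A ⊆ B) (hB : FeasibleAlloc c E B) :
    FeasibleAlloc c E A := fun i =>
  have h := filter_subset_filter (fun p : I × J => p.1 = i) hAB
  ⟨(sum_le_sum_of_subset_of_nonneg h fun p _ _ => hc p).trans (hB i).1,
    (card_le_card h).trans (hB i).2⟩

theorem cost_le (hc : ∀ p, 0 ≤ c p) (hA : FeasibleAlloc c E A) {x : I × J} (hx : x ∈ A) :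
    c x ≤ E x.1 :=
  have hmem : x ∈ A.filter (fun p => p.1 = x.1) := mem_filter.2 ⟨hx, rfl⟩
  (single_le_sum (fun p _ => hc p) hmem).trans (hA x.1).1

theorem injOn_fst (hA : FeasibleAlloc c E A) : Set.InjOn Prod.fst (A : Set (I × J)) :=
  fun x hx y hy hxy =>
    card_le_one.1 (hA x.1).2 x (mem_filter.2 ⟨hx, rfl⟩) y (mem_filter.2 ⟨hy, hxy.symm⟩)

/-- An agent without a task can be given any single task it can afford. -/
theorem insert_of_unassigned [DecidableEq J] (hA : FeasibleAlloc c E A) {x : I × J}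
    (hx : ∀ p ∈ A, p.1 ≠ x.1) (hcx : c x ≤ E x.1) : FeasibleAlloc c E (insert x A) := by
  intro i
  rw [filter_insert]
  split_ifs with hi
  · subst hi
    rw [filter_eq_empty_iff.2 fun p hp => hx p hp]
    simpa using hcx
  · exact hA i

/-- Every feasible subset of `B` is at most as large as any maximal one. -/
theorem card_le_of_maximal [DecidableEq J] {A₁ A₂ : Finset (I × J)} (hc : ∀ p, 0 ≤ c p)
    (hsub : A₁ ⊆ B) (h₁ : FeasibleAlloc c E A₁) (h₂ : FeasibleAlloc c E A₂)
    (hmax : ∀ x ∈ B, x ∉ A₂ → ¬ FeasibleAlloc c E (insert x A₂)) :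
    A₁.card ≤ A₂.card := by
  have himage : A₁.image Prod.fst ⊆ A₂.image Prod.fst := by
    intro i hi
    obtain ⟨x, hx, rfl⟩ := mem_image.1 hi
    by_contra hnot
    have hfree : ∀ p ∈ A₂, p.1 ≠ x.1 := fun p hp hpx => hnot (mem_image.2 ⟨p, hp, hpx⟩)
    exact hmax x (hsub hx) (fun h => hfree x h rfl)
      (h₂.insert_of_unassigned hfree (h₁.cost_le hc hx))
  calc A₁.card = (A₁.image Prod.fst).card := (card_image_of_injOn h₁.injOn_fst).symm
    _ ≤ (A₂.image Prod.fst).card := card_le_card himage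
    _ ≤ A₂.card := card_image_le

end FeasibleAlloc

/-- **Lemma 7 of the paper.** The per-agent budget constraints together with the
conflict-free (at-most-one-task-per-agent) constraint form a `q`-independent system
on the ground set `I × J`, with `q = ⌈1 + C_max/C_min⌉`: (a) the empty set is
feasible and feasibility is hereditary; (b) any two maximal feasible subsets (bases)
of a set `A` have sizes within a multiplicative factor `q` of each other. -/
theorem budget_conflict_q_independent_system
    {I J : Type*} [Fintype I] [Fintype J] [Nonempty I] [Nonempty J]
    [DecidableEq I] [DecidableEq J]
    (c : I × J → ℝ) (Cmin Cmax : ℝ)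
    (hCmin : 0 < Cmin)
    (hc : ∀ p : I × J, Cmin ≤ c p ∧ c p ≤ Cmax)
    (E : I → ℝ) (hE : ∀ i, 0 ≤ E i) :
    (FeasibleAlloc c E (∅ : Finset (I × J)) ∧
      ∀ A A' : Finset (I × J), A ⊆ A' → FeasibleAlloc c E A' → FeasibleAlloc c E A) ∧
    (∀ A A₁ A₂ : Finset (I × J),
      A₁ ⊆ A → A₂ ⊆ A →
      FeasibleAlloc c E A₁ → FeasibleAlloc c E A₂ →
      (∀ x ∈ A, x ∉ A₁ → ¬ FeasibleAlloc c E (insert x A₁)) →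
      (∀ x ∈ A, x ∉ A₂ → ¬ FeasibleAlloc c E (insert x A₂)) →
      (A₁.card : ℝ) ≤ (⌈1 + Cmax / Cmin⌉ : ℤ) * A₂.card) := by
  have hc0 : ∀ p, 0 ≤ c p := fun p => hCmin.le.trans (hc p).1
  refine ⟨⟨.empty hE, fun _ _ h hA' => hA'.mono hc0 h⟩, ?_⟩
  intro A A₁ A₂ h₁A _ h₁ h₂ _ hmax
  have hcard : (A₁.card : ℝ) ≤ A₂.card :=
    mod_cast FeasibleAlloc.card_le_of_maximal hc0 h₁A h₁ h₂ hmax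
  have hCmax : 0 ≤ Cmax := (hc0 (Classical.arbitrary _)).trans (hc _).2
  have hq : (1 : ℝ) ≤ (⌈1 + Cmax / Cmin⌉ : ℤ) :=
    (le_add_of_nonneg_right (div_nonneg hCmax hCmin.le)).trans (Int.le_ceil _)
  exact hcard.trans (le_mul_of_one_le_left (Nat.cast_nonneg _) hq)
end
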